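/- Let K be a commutative Noetherian normal domain, n ≥ 2, X the generic n×n matrix over K with entries in S = K[x_{ij}], R = S/(det X), and let L be the cokernel of the S-linear map Sⁿ → Sⁿ given by X. Then Ext¹_S(L, L), computed over S, is isomorphic as an S-module to the ideal I_{n−1}(X)/(det X) of R, i.e., to the image of the ideal I_{n−1}(X) ⊆ S in R = S/(det X). -/

import Mathlib

open Matrix CategoryTheory

noncomputable section

/-- The generic `n × n` matrix, whose `(i,j)` entry is the indeterminate `x_{ij}` of the
polynomial ring `S = K[x_{ij}]`. -/
def genericMatrix (K : Type*) [CommRing K] (n : ℕ) :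
    Matrix (Fin n) (Fin n) (MvPolynomial (Fin n × Fin n) K) :=
  Matrix.of fun i j => MvPolynomial.X (i, j)

/-- The ideal `I_{n-1}(X) ⊆ S` generated by the `(n-1) × (n-1)` minors of the generic matrix. -/
def minorsIdeal (K : Type*) [CommRing K] (n : ℕ) :
    Ideal (MvPolynomial (Fin n × Fin n) K) :=
  Ideal.span { d | ∃ f g : Fin (n - 1) → Fin n, StrictMono f ∧ StrictMono g ∧
    d = ((genericMatrix K n).submatrix f g).det }

namespace MonomialOrder

variable {σ ι R : Type*} [CommRing R] (m : MonomialOrder σ)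

open MvPolynomial in
/-- Reduction modulo a finite family with unit leading coefficients. -/
theorem exists_sub_mem_span_reduced {p : ι → MvPolynomial σ R}
    (hp : ∀ i, IsUnit (m.leadingCoeff (p i))) (s : Set ι) (f : MvPolynomial σ R) :
    ∃ r, f - r ∈ Ideal.span (p '' s) ∧
      (r ≠ 0 → ∀ i ∈ s, ¬ m.degree (p i) ≤ m.degree r) := by
  obtain ⟨g, r, h₁, -, h₂⟩ := m.div (b := fun i : s => p i) (fun i => hp i) f
  refine ⟨r, ?_, fun hr i hi => h₂ _ (m.degree_mem_support hr) ⟨i, hi⟩⟩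
  rw [h₁, add_sub_cancel_right, Finsupp.linearCombination_apply]
  refine Ideal.sum_mem _ fun i _ => ?_
  exact Ideal.mul_mem_left _ _ (Ideal.subset_span ⟨i, i.2, rfl⟩)

variable [IsDomain R]

/-- A finite family with unit leading coefficients and pairwise coprime leading monomials is a
Gröbner basis. -/
theorem exists_degree_le_of_mem_span {p : ι → MvPolynomial σ R}
    (hp : ∀ i, IsUnit (m.leadingCoeff (p i)))
    (hd : ∀ i j, i ≠ j → Disjoint (m.degree (p i)) (m.degree (p j)))
    (s : Finset ι) {z : MvPolynomial σ R} (hz : z ∈ Ideal.span (p '' s)) (hz0 : z ≠ 0) :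
    ∃ i ∈ s, m.degree (p i) ≤ m.degree z := by
  classical
  induction s using Finset.induction_on generalizing z with
  | empty => simp_all
  | insert k s hk ih =>
    rw [Finset.coe_insert, Set.image_insert_eq, Ideal.mem_span_insert] at hz
    obtain ⟨g, w, hw, rfl⟩ := hz
    obtain ⟨r, hr, hr'⟩ := m.exists_sub_mem_span_reduced hp s g
    have hpk : p k ≠ 0 := m.leadingCoeff_ne_zero_iff.1 (hp k).ne_zero
    set z' := (g - r) * p k + w with hz'
    have hmem : z' ∈ Ideal.span (p '' s) := add_mem (Ideal.mul_mem_right _ _ hr) hw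
    have heq : g * p k + w = z' + r * p k := by rw [hz']; ring
    rw [heq] at hz0 ⊢
    by_cases hr0 : r = 0
    · subst hr0
      simp only [zero_mul, add_zero] at hz0 ⊢
      obtain ⟨i, hi, h⟩ := ih hmem hz0
      exact ⟨i, Finset.mem_insert_of_mem hi, h⟩
    have hdeg : m.degree (r * p k) = m.degree r + m.degree (p k) := m.degree_mul hr0 hpk
    by_cases hz'0 : z' = 0
    · exact ⟨k, Finset.mem_insert_self _ _, by simp [hz'0, hdeg]⟩
    obtain ⟨i, hi, h⟩ := ih hmem hz'0
    have hne : m.degree z' ≠ m.degree (r * p k) := by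
      intro h'
      refine hr' hr0 i hi ?_
      rw [h', hdeg] at h
      intro x
      have h1 := h x
      have h2 := DFunLike.congr_fun (disjoint_iff.1 (hd i k (by rintro rfl; exact hk hi))) x
      simp only [Finsupp.inf_apply, _root_.bot_eq_zero, Finsupp.coe_zero, Pi.zero_apply,
        Finsupp.add_apply] at h1 h2 ⊢
      omega
    have hmax := m.degree_add_of_ne hne
    rcases max_choice (m.toSyn (m.degree z')) (m.toSyn (m.degree (r * p k))) with h1 | h1
    · rw [h1] at hmax
      exact ⟨i, Finset.mem_insert_of_mem hi, (m.toSyn.injective hmax).symm ▸ h⟩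
    · rw [h1] at hmax
      refine ⟨k, Finset.mem_insert_self _ _, (m.toSyn.injective hmax).symm ▸ ?_⟩
      rw [hdeg]
      exact le_add_self

/-- If the least common multiple of the monomials which multiply the leading monomials of
the `q j` into the initial ideal lies in the initial ideal, then the colon ideal is trivial. -/
theorem mem_span_of_forall_mul_mem {κ : Type*} {p : ι → MvPolynomial σ R}
    (hp : ∀ i, IsUnit (m.leadingCoeff (p i)))
    (hd : ∀ i j, i ≠ j → Disjoint (m.degree (p i)) (m.degree (p j)))
    (s : Finset ι) (q : κ → MvPolynomial σ R) (hq0 : ∀ j, q j ≠ 0)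
    (hq : ∀ d, (∀ j, ∃ i ∈ s, m.degree (p i) ≤ d + m.degree (q j)) →
      ∃ i ∈ s, m.degree (p i) ≤ d)
    {h : MvPolynomial σ R} (hh : ∀ j, h * q j ∈ Ideal.span (p '' s)) :
    h ∈ Ideal.span (p '' s) := by
  obtain ⟨r, hr, hr'⟩ := m.exists_sub_mem_span_reduced hp s h
  by_cases hr0 : r = 0
  · simpa [hr0] using hr
  obtain ⟨i, hi, hle⟩ := hq (m.degree r) fun j => by
    rw [← m.degree_mul hr0 (hq0 j)]
    refine m.exists_degree_le_of_mem_span hp hd s ?_ (mul_ne_zero hr0 (hq0 j))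
    have : r * q j = h * q j - (h - r) * q j := by ring
    rw [this]
    exact sub_mem (hh j) (Ideal.mul_mem_right _ _ hr)
  exact absurd hle (hr' hr0 i hi)

theorem mem_span_of_mul_mem {p : ι → MvPolynomial σ R}
    (hp : ∀ i, IsUnit (m.leadingCoeff (p i)))
    (hd : ∀ i j, i ≠ j → Disjoint (m.degree (p i)) (m.degree (p j)))
    (s : Finset ι) {k : ι} (hk : k ∉ s) {h : MvPolynomial σ R}
    (hh : h * p k ∈ Ideal.span (p '' s)) :
    h ∈ Ideal.span (p '' s) := by
  refine m.mem_span_of_forall_mul_mem hp hd s (fun _ : Unit => p k)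
    (fun _ => m.leadingCoeff_ne_zero_iff.1 (hp k).ne_zero) (fun d hd' => ?_) (fun _ => hh)
  obtain ⟨i, hi, hle⟩ := hd' ()
  refine ⟨i, hi, fun x => ?_⟩
  have h1 := hle x
  have h2 := DFunLike.congr_fun (disjoint_iff.1 (hd i k (by rintro rfl; exact hk hi))) x
  simp only [Finsupp.inf_apply, _root_.bot_eq_zero, Finsupp.coe_zero, Pi.zero_apply,
    Finsupp.add_apply] at h1 h2 ⊢
  omega

end MonomialOrder

namespace Matrix

variable {ι S : Type*} [Fintype ι] [DecidableEq ι] [CommRing S]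

theorem exists_mulVec_eq_adjugate_smul_sub (X : Matrix ι ι S) (p q i : ι) :
    ∃ c : ι → S, X *ᵥ c =
      X.adjugate p q • Pi.single i 1 - X.adjugate p i • Pi.single q 1 := by
  by_cases hiq : i = q
  · exact ⟨0, by simp [hiq]⟩
  set X' := X.updateRow q (Pi.single p 1) with hX'
  have hdet : X'.det = X.adjugate p q := (X.adjugate_apply p q).symm
  refine ⟨fun r => X'.adjugate r i, funext fun k => ?_⟩
  by_cases hk : k = q
  · subst hk
    have h1 : (X *ᵥ fun r => X'.adjugate r i) k = (X'.updateRow i (X k)).det := by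
      rw [det_eq_sum_mul_adjugate_row _ i]
      simp [mulVec, dotProduct, adjugate_apply]
    have h2 : X'.updateRow i (X k) =
        (X.updateRow i (Pi.single p 1)).submatrix (Equiv.swap i k) id := by
      ext a b
      by_cases ha : a = i
      · subst ha
        simp [Ne.symm hiq]
      by_cases hb : a = k
      · subst hb
        simp [hX', ha]
      · simp [hX', ha, hb, Equiv.swap_apply_of_ne_of_ne ha hb]
    rw [h1, h2, det_permute, Equiv.Perm.sign_swap hiq, ← adjugate_apply]
    simp [Ne.symm hiq]
  · have h := congrFun₂ (mul_adjugate X') k i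
    rw [hdet, mul_apply] at h
    simp only [hX', updateRow_ne hk] at h
    simp only [mulVec, dotProduct, hX']
    rw [h]
    simp [hk, one_apply, Pi.single_apply]

/-- The `S`-submodule of all matrices of the form `X * M + N * X`. -/
abbrev mulRangeSup (X : Matrix ι ι S) : Submodule S (Matrix ι ι S) :=
  LinearMap.range (LinearMap.mulLeft S X) ⊔ LinearMap.range (LinearMap.mulRight S X)

theorem mem_mulRangeSup {X A : Matrix ι ι S} :
    A ∈ mulRangeSup X ↔ ∃ M N, X * M + N * X = A := by
  simp [mulRangeSup, Submodule.mem_sup]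

theorem adjugate_smul_single_sub_mem (X : Matrix ι ι S) (p q i j : ι) :
    X.adjugate p q • single i j (1 : S) - X.adjugate j i • single q p 1 ∈ mulRangeSup X := by
  obtain ⟨c, hc⟩ := X.exists_mulVec_eq_adjugate_smul_sub p q i
  obtain ⟨d, hd⟩ := Xᵀ.exists_mulVec_eq_adjugate_smul_sub i p j
  rw [mulVec_transpose, ← adjugate_transpose] at hd
  refine mem_mulRangeSup.2
    ⟨vecMulVec c (Pi.single j 1), vecMulVec (Pi.single q 1) d, ?_⟩
  rw [mul_vecMulVec, vecMulVec_mul, hc, hd]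
  simp only [sub_vecMulVec, vecMulVec_sub, smul_vecMulVec, vecMulVec_smul, transpose_apply,
    ← single_eq_single_vecMulVec_single]
  abel

theorem adjugate_smul_sub_trace_smul_mem (X A : Matrix ι ι S) (p q : ι) :
    X.adjugate p q • A - (X.adjugate * A).trace • single q p 1 ∈ mulRangeSup X := by
  have h : X.adjugate p q • A - (X.adjugate * A).trace • single q p 1 =
      ∑ i, ∑ j, A i j •
        (X.adjugate p q • single i j (1 : S) - X.adjugate j i • single q p 1) := by
    conv_lhs => enter [1]; rw [matrix_eq_sum_single A]
    simp only [smul_sub, Finset.sum_sub_distrib, Finset.smul_sum, smul_smul]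
    congr 1
    · refine Finset.sum_congr rfl fun i _ => Finset.sum_congr rfl fun j _ => ?_
      simp [smul_single, mul_comm]
    · simp only [← Finset.sum_smul]
      rw [Finset.sum_comm]
      congr 1
      simp [trace, mul_apply, mul_comm]
  rw [h]
  exact sum_mem fun i _ => sum_mem fun j _ => Submodule.smul_mem _ _
    (adjugate_smul_single_sub_mem X p q i j)

theorem det_smul_mem_mulRangeSup (X A : Matrix ι ι S) : X.det • A ∈ mulRangeSup X :=
  mem_mulRangeSup.2 ⟨X.adjugate * A, 0, by simp [← mul_assoc, mul_adjugate]⟩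

theorem adjugate_smul_mem_of_dvd_trace {X A : Matrix ι ι S}
    (h : X.det ∣ (X.adjugate * A).trace) (p q : ι) :
    X.adjugate p q • A ∈ mulRangeSup X := by
  obtain ⟨s, hs⟩ := h
  have := add_mem (adjugate_smul_sub_trace_smul_mem X A p q)
    (det_smul_mem_mulRangeSup X (s • single q p 1))
  rwa [hs, smul_smul, sub_add_cancel] at this

theorem det_dvd_trace_of_mem {X A : Matrix ι ι S} (h : A ∈ mulRangeSup X) :
    X.det ∣ (X.adjugate * A).trace := by
  obtain ⟨M, N, rfl⟩ := mem_mulRangeSup.1 h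
  refine ⟨M.trace + N.trace, ?_⟩
  rw [mul_add, trace_add, ← mul_assoc, adjugate_mul, trace_mul_comm X.adjugate, mul_assoc,
    mul_adjugate]
  simp [mul_add]

/-- An endomorphism of the cokernel of `X` is a scalar. -/
theorem exists_eq_scalar_add_of_mul_eq_mul {X M N : Matrix ι ι S} {p q p' q' : ι}
    (h0 : IsLeftRegular X.det)
    (h1 : ∀ s, X.det ∣ s * X.adjugate p q → X.det ∣ s)
    (h2 : ∀ s, s * X.adjugate p' q' ∈ Ideal.span {X.det, X.adjugate p q} →
      s ∈ Ideal.span {X.det, X.adjugate p q})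
    (h : X * M = N * X) :
    ∃ (c : S) (Y : Matrix ι ι S), M = c • 1 + Y * X ∧ N = c • 1 + X * Y := by
  set B := X.adjugate with hB
  set C := B * N with hC
  have hcancel {P Q : Matrix ι ι S} (hPQ : X.det • P = X.det • Q) : P = Q := by
    ext i j
    exact h0 (by simpa using congrFun₂ hPQ i j)
  have hCX : C * X = X.det • M := by
    rw [hC, mul_assoc, ← h, ← mul_assoc, hB, adjugate_mul, smul_mul, one_mul]
  have hCM : C = M * B := by
    refine hcancel ?_
    have := congrArg (· * B) hCX
    simpa [mul_assoc, hB, mul_adjugate] using this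
  -- The `2 × 2` minors of the adjugate are divisible by the determinant.
  have hminor (i j k l : ι) : X.det ∣ B i j * B k l - B i l * B k j := by
    obtain ⟨c, hc⟩ := X.exists_mulVec_eq_adjugate_smul_sub i j l
    refine ⟨c k, ?_⟩
    have := congrFun (congrArg (B *ᵥ ·) hc) k
    simp only [mulVec_mulVec, hB, adjugate_mul, smul_mulVec, one_mulVec, mulVec_sub,
      mulVec_smul, mulVec_single_one, Pi.smul_apply, Pi.sub_apply, smul_eq_mul, col_apply] at this
    rw [this]
  have hCB1 (i j k l : ι) : X.det ∣ C i j * B k l - C k j * B i l := by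
    simp only [hC, mul_apply, Finset.sum_mul, ← Finset.sum_sub_distrib]
    refine Finset.dvd_sum fun t _ => ?_
    obtain ⟨u, hu⟩ := hminor i t k l
    exact ⟨u * N t j, by linear_combination N t j * hu⟩
  have hCB2 (i j k l : ι) : X.det ∣ C k j * B i l - C k l * B i j := by
    simp only [hCM, mul_apply, Finset.sum_mul, ← Finset.sum_sub_distrib]
    refine Finset.dvd_sum fun t _ => ?_
    obtain ⟨u, hu⟩ := hminor t j i l
    exact ⟨M k t * u, by linear_combination M k t * hu⟩
  have hCB (i j k l : ι) : X.det ∣ C i j * B k l - C k l * B i j := by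
    have := dvd_add (hCB1 i j k l) (hCB2 i j k l)
    rwa [sub_add_sub_cancel] at this
  obtain ⟨d, c, hdc⟩ := Ideal.mem_span_pair.1 (h2 (C p q) (by
    obtain ⟨u, hu⟩ := hCB p q p' q'
    exact Ideal.mem_span_pair.2 ⟨u, C p' q', by linear_combination -hu⟩))
  have hY (i j : ι) : X.det ∣ C i j - c * B i j := by
    refine h1 _ ?_
    obtain ⟨u, hu⟩ := hCB i j p q
    exact ⟨u + d * B i j, by linear_combination hu - B i j * hdc⟩
  choose Y hY using hY
  have hCY : C = c • B + X.det • of Y := by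
    ext i j
    simpa [sub_eq_iff_eq_add'] using hY i j
  refine ⟨c, of Y, hcancel ?_, hcancel ?_⟩
  · rw [← hCX, hCY, add_mul, smul_mul, smul_mul, hB, adjugate_mul, smul_add, smul_comm c]
  · have : X.det • N = X * C := by
      rw [hC, ← mul_assoc, hB, mul_adjugate, smul_mul, one_mul]
    rw [this, hCY, mul_add, Matrix.mul_smul, Matrix.mul_smul, hB, mul_adjugate, smul_add,
      smul_comm c]

theorem mem_mulRangeSup_of_adjugate_smul_mem {X A : Matrix ι ι S} {p q p' q' : ι}
    (h0 : IsLeftRegular X.det)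
    (h1 : ∀ s, X.det ∣ s * X.adjugate p q → X.det ∣ s)
    (h2 : ∀ s, s * X.adjugate p' q' ∈ Ideal.span {X.det, X.adjugate p q} →
      s ∈ Ideal.span {X.det, X.adjugate p q})
    (h3 : IsLeftRegular (X.adjugate p q))
    (h4 : ∀ s, X.adjugate p q ∣ s * X.adjugate p' q' → X.adjugate p q ∣ s)
    (h5 : ∀ s, s * X.det ∈ Ideal.span {X.adjugate p q, X.adjugate p' q'} →
      s ∈ Ideal.span {X.adjugate p q, X.adjugate p' q'})
    (h6 : ∀ s, (∀ i j, s * X.adjugate i j ∈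
        Ideal.span {X.det, X.adjugate p q, X.adjugate p' q'}) →
      s ∈ Ideal.span {X.det, X.adjugate p q, X.adjugate p' q'})
    (h : ∀ i j, X.adjugate i j • A ∈ mulRangeSup X) : A ∈ mulRangeSup X := by
  obtain ⟨M, N, hA⟩ := mem_mulRangeSup.1 (h p q)
  obtain ⟨M', N', hA'⟩ := mem_mulRangeSup.1 (h p' q')
  set B := X.adjugate with hB
  set b := B p q
  set b' := B p' q'
  obtain ⟨c, Y, hM, hN⟩ := exists_eq_scalar_add_of_mul_eq_mul (M := b' • M - b • M')
    (N := b • N' - b' • N) h0 h1 h2 (by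
      have := congrArg (b' • ·) hA
      have h'' := congrArg (b • ·) hA'
      simp only [smul_smul] at this h''
      rw [mul_comm b', ← h''] at this
      simp only [smul_add] at this
      rw [mul_sub, sub_mul, Matrix.mul_smul, Matrix.mul_smul, smul_mul, smul_mul,
        sub_eq_sub_iff_add_eq_add, this, add_comm])
  have hcB (i j : ι) :
      c * B i j + X.det * Y i j = b' * (M * B) i j - b * (M' * B) i j := by
    have := congrArg (· * B) hM
    simp only [sub_mul, add_mul, smul_mul, one_mul, mul_assoc, hB, mul_adjugate,
      Matrix.mul_smul, mul_one] at this
    simpa [hB] using (congrFun₂ this i j).symm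
  obtain ⟨d, e, he, rfl⟩ := Ideal.mem_span_insert.1 (h6 c fun i j =>
    Ideal.mem_span_insert.2 ⟨-Y i j, b' * (M * B) i j - b * (M' * B) i j,
      Ideal.mem_span_pair.2 ⟨-(M' * B) i j, (M * B) i j, by ring⟩,
      by linear_combination hcB i j⟩)
  obtain ⟨e₁, e₂, rfl⟩ := Ideal.mem_span_pair.1 he
  have hY (i j : ι) : ∃ y₁ y₂, y₁ * b + y₂ * b' = d * B i j + Y i j :=
    Ideal.mem_span_pair.1 (h5 _ (Ideal.mem_span_pair.2
      ⟨-(M' * B) i j - e₁ * B i j, (M * B) i j - e₂ * B i j, by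
        linear_combination -hcB i j⟩))
  choose Y₁ Y₂ hY using hY
  obtain rfl : Y = b • of Y₁ + b' • of Y₂ - d • B := by
    ext i j
    simp only [sub_apply, add_apply, smul_apply, smul_eq_mul, of_apply]
    linear_combination -hY i j
  have hM' : b' • (M - e₂ • 1 - of Y₂ * X) = b • (M' + e₁ • 1 + of Y₁ * X) := by
    simp only [sub_mul, add_mul, smul_mul, hB, adjugate_mul] at hM
    rw [sub_eq_iff_eq_add] at hM
    simp only [smul_sub, smul_add, hM]
    module
  have hN' : b' • (N + e₂ • 1 + X * of Y₂) = b • (N' - e₁ • 1 - X * of Y₁) := by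
    simp only [mul_sub, mul_add, Matrix.mul_smul, hB, mul_adjugate] at hN
    rw [sub_eq_iff_eq_add] at hN
    simp only [smul_sub, smul_add, hN]
    module
  have hW (i j : ι) : b ∣ (M - e₂ • 1 - of Y₂ * X) i j := h4 _ ⟨_,
    (mul_comm _ _).trans (congrFun₂ hM' i j)⟩
  have hW' (i j : ι) : b ∣ (N + e₂ • 1 + X * of Y₂) i j := h4 _ ⟨_,
    (mul_comm _ _).trans (congrFun₂ hN' i j)⟩
  choose W hW using hW
  choose W' hW' using hW'
  have hMW : M - e₂ • 1 - of Y₂ * X = b • of W := by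
    ext i j
    simpa using hW i j
  have hNW : N + e₂ • 1 + X * of Y₂ = b • of W' := by
    ext i j
    simpa using hW' i j
  refine mem_mulRangeSup.2 ⟨of W, of W', ?_⟩
  ext i j
  refine h3 ?_
  have : b • (X * of W + of W' * X) = b • A := by
    rw [← hA, smul_add, ← Matrix.mul_smul, ← smul_mul, ← hMW, ← hNW]
    simp only [mul_sub, add_mul, Matrix.mul_smul, smul_mul, mul_one, one_mul, mul_assoc]
    abel
  simpa using congrFun₂ this i j

end Matrix

/-- The lexicographic monomial order on monomials in the entries of a matrix, with the
variables ordered row by row. -/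
def MonomialOrder.prodLex (α β : Type*) [LinearOrder α] [LinearOrder β] [Finite α] [Finite β] :
    MonomialOrder (α × β) where
  syn := Lex ((α ×ₗ β) →₀ ℕ)
  toSyn := (Finsupp.domCongr toLex).trans { toEquiv := toLex, map_add' := toLex_add }
  toSyn_monotone _ _ h := Finsupp.toLex_monotone fun x => h (ofLex x)
  wellFoundedLT_syn :=
    haveI : Finite (α ×ₗ β) := inferInstanceAs (Finite (α × β))
    haveI : WellFoundedGT (α ×ₗ β) := Finite.to_wellFoundedGT
    inferInstance

theorem MonomialOrder.prodLex_lt {α β : Type*} [LinearOrder α] [LinearOrder β] [Finite α]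
    [Finite β] {c d : α × β →₀ ℕ} (p : α × β)
    (h : ∀ q, toLex q < toLex p → c q = d q) (hp : c p < d p) :
    (MonomialOrder.prodLex α β).toSyn c < (MonomialOrder.prodLex α β).toSyn d :=
  ⟨toLex p, fun q hq => h (ofLex q) hq, hp⟩

namespace Matrix

variable {α β κ : Type*} [LinearOrder α] [LinearOrder β] [Finite α] [Finite β]
  [LinearOrder κ] [Fintype κ]

theorem prodLex_permutation_lt {f : κ → α} {g : κ → β} (hf : StrictMono f) (hg : StrictMono g)
    {τ : Equiv.Perm κ} (hτ : τ ≠ 1) :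
    (MonomialOrder.prodLex α β).toSyn (∑ i, Finsupp.single (f i, g (τ i)) 1) <
      (MonomialOrder.prodLex α β).toSyn (∑ i, Finsupp.single (f i, g i) 1) := by
  classical
  have hne : (Finset.univ.filter fun i => τ i ≠ i).Nonempty := by
    obtain ⟨i, hi⟩ := not_forall.1 fun h => hτ (Equiv.ext h)
    exact ⟨i, by simpa using hi⟩
  set i₀ := Finset.min' _ hne
  have hi₀ : τ i₀ ≠ i₀ := (Finset.mem_filter.1 (Finset.min'_mem _ hne)).2
  have hlt (i) (hi : i < i₀) : τ i = i := by
    by_contra h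
    exact hi.not_ge (Finset.min'_le _ _ (by simpa using h))
  have hτi₀ : i₀ < τ i₀ := by
    rcases lt_or_gt_of_ne hi₀ with h | h
    · exact absurd (τ.injective (hlt _ h)) hi₀
    · exact h
  have hgt (i) (hi : i₀ ≤ i) : toLex (f i₀, g i₀) < toLex (f i, g (τ i)) := by
    rcases hi.eq_or_lt with rfl | hi
    · exact Prod.Lex.toLex_lt_toLex.2 (Or.inr ⟨rfl, hg hτi₀⟩)
    · exact Prod.Lex.toLex_lt_toLex.2 (Or.inl (hf hi))
  have hge (i) (hi : i₀ ≤ i) : toLex (f i₀, g i₀) ≤ toLex (f i, g i) :=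
    Prod.Lex.toLex_mono ⟨hf.monotone hi, hg.monotone hi⟩
  refine MonomialOrder.prodLex_lt (f i₀, g i₀) (fun q hq => ?_) ?_
  · simp only [Finsupp.coe_finsetSum, Finset.sum_apply]
    refine Finset.sum_congr rfl fun i _ => ?_
    rcases lt_or_ge i i₀ with hi | hi
    · rw [hlt i hi]
    · rw [Finsupp.single_eq_of_ne, Finsupp.single_eq_of_ne]
      · rintro rfl
        exact (hq.trans_le (hge i hi)).false
      · rintro rfl
        exact (hq.trans (hgt i hi)).false
  · simp only [Finsupp.coe_finsetSum, Finset.sum_apply]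
    refine (Finset.sum_eq_zero fun i _ => Finsupp.single_eq_of_ne fun h => ?_).trans_lt
      (Finset.sum_pos' (fun _ _ => zero_le) ⟨i₀, Finset.mem_univ _, by simp⟩)
    obtain ⟨h1, h2⟩ := Prod.ext_iff.1 h
    obtain rfl := hf.injective h1
    exact hi₀ (hg.injective h2).symm

open MvPolynomial in
theorem degree_leadingCoeff_det_submatrix {R : Type*} [CommRing R] [Nontrivial R]
    {f : κ → α} {g : κ → β} (hf : StrictMono f) (hg : StrictMono g) :
    (MonomialOrder.prodLex α β).degree
        (of fun i j => X (R := R) (f i, g j)).det = ∑ i, Finsupp.single (f i, g i) 1 ∧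
      (MonomialOrder.prodLex α β).Monic (of fun i j => X (R := R) (f i, g j)).det := by
  classical
  set m := MonomialOrder.prodLex α β
  set D : Equiv.Perm κ → α × β →₀ ℕ := fun τ => ∑ i, Finsupp.single (f i, g (τ i)) 1 with hD
  have hdet : (of fun i j => X (R := R) (f i, g j)).det =
      ∑ τ : Equiv.Perm κ, monomial (D τ) ((Equiv.Perm.sign τ : ℤ) : R) := by
    rw [← det_transpose, det_apply]
    refine Finset.sum_congr rfl fun τ _ => ?_
    have : ∏ i, X (R := R) (f i, g (τ i)) = monomial (D τ) 1 := by
      simp only [X, hD, monomial_sum_one]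
    simp only [transpose_apply, of_apply, this, Units.smul_def, smul_monomial]
    simp
  have hle (τ : Equiv.Perm κ) : m.toSyn (D τ) ≤ m.toSyn (D 1) := by
    by_cases h : τ = 1
    · rw [h]
    · exact (prodLex_permutation_lt hf hg h).le
  have hcoeff : coeff (D 1) (of fun i j => X (R := R) (f i, g j)).det = 1 := by
    rw [hdet, coeff_sum, Finset.sum_eq_single 1]
    · simp
    · intro τ _ hτ
      rw [coeff_monomial, if_neg]
      exact fun h => (prodLex_permutation_lt hf hg hτ).ne (congrArg m.toSyn h)
    · simp
  have hdeg : m.degree (of fun i j => X (R := R) (f i, g j)).det = D 1 := by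
    refine m.toSyn.injective (le_antisymm ?_ (m.le_degree ?_))
    · rw [hdet]
      refine m.degree_sum_le.trans (Finset.sup_le fun τ _ => ?_)
      exact (m.degree_monomial_le _).trans (hle τ)
    · rw [mem_support_iff, hcoeff]
      exact one_ne_zero
  refine ⟨hdeg, ?_⟩
  rw [MonomialOrder.Monic, MonomialOrder.leadingCoeff, hdeg, hcoeff]

end Matrix

section Generic

open MvPolynomial Matrix

variable (K : Type*) [CommRing K] [IsDomain K] (k : ℕ)

/-- The monomial order for which the leading monomial of every minor is its diagonal. -/
abbrev diagonalOrder (n : ℕ) : MonomialOrder (Fin n × Fin n) := MonomialOrder.prodLex _ _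

theorem degree_det_genericMatrix (n : ℕ) :
    (diagonalOrder n).degree (genericMatrix K n).det = ∑ i, Finsupp.single (i, i) 1 ∧
      IsUnit ((diagonalOrder n).leadingCoeff (genericMatrix K n).det) := by
  obtain ⟨h₁, h₂⟩ :=
    degree_leadingCoeff_det_submatrix (R := K) (strictMono_id (α := Fin n)) strictMono_id
  exact ⟨h₁, h₂.leadingCoeff_eq_one ▸ isUnit_one⟩

theorem degree_adjugate_genericMatrix (i j : Fin (k + 1)) :
    (diagonalOrder (k + 1)).degree ((genericMatrix K (k + 1)).adjugate i j) =
        ∑ a, Finsupp.single (j.succAbove a, i.succAbove a) 1 ∧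
      IsUnit ((diagonalOrder (k + 1)).leadingCoeff
        ((genericMatrix K (k + 1)).adjugate i j)) := by
  obtain ⟨h₁, h₂⟩ := degree_leadingCoeff_det_submatrix (R := K)
    (Fin.strictMono_succAbove j) (Fin.strictMono_succAbove i)
  rw [adjugate_fin_succ_eq_det_submatrix]
  have hX : (genericMatrix K (k + 1)).submatrix j.succAbove i.succAbove =
      of fun a b => X (j.succAbove a, i.succAbove b) := rfl
  rw [hX]
  rcases neg_one_pow_eq_or (MvPolynomial (Fin (k + 1) × Fin (k + 1)) K) (j + i : ℕ) with h | h
  · rw [h, one_mul]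
    exact ⟨h₁, h₂.leadingCoeff_eq_one ▸ isUnit_one⟩
  · rw [h, neg_one_mul, MonomialOrder.degree_neg, MonomialOrder.leadingCoeff_neg]
    exact ⟨h₁, h₂.leadingCoeff_eq_one ▸ isUnit_one.neg⟩

theorem adjugate_genericMatrix_ne_zero (i j : Fin (k + 1)) :
    (genericMatrix K (k + 1)).adjugate i j ≠ 0 :=
  (diagonalOrder _).leadingCoeff_ne_zero_iff.1 (degree_adjugate_genericMatrix K k i j).2.ne_zero

theorem det_genericMatrix_ne_zero (n : ℕ) : (genericMatrix K n).det ≠ 0 :=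
  (diagonalOrder _).leadingCoeff_ne_zero_iff.1 (degree_det_genericMatrix K n).2.ne_zero

/-- The determinant of the generic matrix, together with two opposite corners of the adjugate.
Their leading monomials are pairwise coprime. -/
def detAndCorners : Fin 3 → MvPolynomial (Fin (k + 1) × Fin (k + 1)) K :=
  ![(genericMatrix K (k + 1)).det, (genericMatrix K (k + 1)).adjugate 0 (Fin.last k),
    (genericMatrix K (k + 1)).adjugate (Fin.last k) 0]

theorem isUnit_leadingCoeff_detAndCorners (i : Fin 3) :
    IsUnit ((diagonalOrder (k + 1)).leadingCoeff (detAndCorners K k i)) := by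
  fin_cases i
  · exact (degree_det_genericMatrix K (k + 1)).2
  · exact (degree_adjugate_genericMatrix K k _ _).2
  · exact (degree_adjugate_genericMatrix K k _ _).2

theorem degree_detAndCorners_apply_eq_zero (i : Fin 3) (x : Fin (k + 1) × Fin (k + 1))
    (hx : ![x.1 ≠ x.2, x.2 ≤ x.1, x.1 ≤ x.2] i) :
    (diagonalOrder (k + 1)).degree (detAndCorners K k i) x = 0 := by
  fin_cases i
  · refine (DFunLike.congr_fun (degree_det_genericMatrix K (k + 1)).1 x).trans ?_
    rw [Finsupp.finsetSum_apply]
    refine Finset.sum_eq_zero fun a _ => Finsupp.single_eq_of_ne ?_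
    rintro rfl
    exact hx rfl
  · refine (DFunLike.congr_fun (degree_adjugate_genericMatrix K k 0 (Fin.last k)).1 x).trans ?_
    rw [Finsupp.finsetSum_apply]
    refine Finset.sum_eq_zero fun a _ => Finsupp.single_eq_of_ne ?_
    rintro rfl
    simp [Fin.le_def] at hx
  · refine (DFunLike.congr_fun (degree_adjugate_genericMatrix K k (Fin.last k) 0).1 x).trans ?_
    rw [Finsupp.finsetSum_apply]
    refine Finset.sum_eq_zero fun a _ => Finsupp.single_eq_of_ne ?_
    rintro rfl
    simp [Fin.le_def] at hx

theorem disjoint_degree_detAndCorners (i j : Fin 3) (hij : i ≠ j) :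
    Disjoint ((diagonalOrder (k + 1)).degree (detAndCorners K k i))
      ((diagonalOrder (k + 1)).degree (detAndCorners K k j)) := by
  rw [disjoint_iff]
  ext x
  rw [Finsupp.inf_apply, _root_.bot_eq_zero, Finsupp.coe_zero, Pi.zero_apply]
  have h := degree_detAndCorners_apply_eq_zero K k
  suffices ![x.1 ≠ x.2, x.2 ≤ x.1, x.1 ≤ x.2] i ∨ ![x.1 ≠ x.2, x.2 ≤ x.1, x.1 ≤ x.2] j by
    rcases this with h' | h'
    · rw [h i x h', Nat.zero_min]
    · rw [h j x h', Nat.min_zero]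
  have h₁ : x.1 ≠ x.2 ∨ x.2 ≤ x.1 := by grind
  have h₂ : x.1 ≠ x.2 ∨ x.1 ≤ x.2 := by grind
  have h₃ : x.2 ≤ x.1 ∨ x.1 ≤ x.2 := le_total _ _
  fin_cases i <;> fin_cases j <;> simp_all [or_comm]

theorem mem_span_of_forall_mul_adjugate_mem
    {s : MvPolynomial (Fin (k + 1) × Fin (k + 1)) K}
    (hs : ∀ i j, s * (genericMatrix K (k + 1)).adjugate i j ∈
      Ideal.span (detAndCorners K k '' (Finset.univ : Finset (Fin 3)))) :
    s ∈ Ideal.span (detAndCorners K k '' (Finset.univ : Finset (Fin 3))) := by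
  refine (diagonalOrder (k + 1)).mem_span_of_forall_mul_mem
    (isUnit_leadingCoeff_detAndCorners K k) (disjoint_degree_detAndCorners K k) Finset.univ
    (fun i => (genericMatrix K (k + 1)).adjugate i i)
    (fun i => adjugate_genericMatrix_ne_zero K k i i) (fun d hd => ?_) (fun i => hs i i)
  have hoff (i : Fin (k + 1)) (x : Fin (k + 1) × Fin (k + 1)) (hx : x.1 ≠ x.2 ∨ x = (i, i)) :
      (diagonalOrder (k + 1)).degree ((genericMatrix K (k + 1)).adjugate i i) x = 0 := by
    rw [(degree_adjugate_genericMatrix K k i i).1, Finsupp.finsetSum_apply]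
    refine Finset.sum_eq_zero fun a _ => Finsupp.single_eq_of_ne ?_
    rintro rfl
    simp [Fin.succAbove_ne] at hx
  have hdiag (i : Fin 3) (hi : i ≠ 0) (a : Fin (k + 1)) :
      (diagonalOrder (k + 1)).degree (detAndCorners K k i) (a, a) = 0 := by
    refine degree_detAndCorners_apply_eq_zero K k i _ ?_
    fin_cases i <;> simp_all
  by_cases h : ∃ j, ∃ i, i ≠ 0 ∧ (diagonalOrder (k + 1)).degree (detAndCorners K k i) ≤
      d + (diagonalOrder (k + 1)).degree ((genericMatrix K (k + 1)).adjugate j j)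
  · obtain ⟨j, i, hi, hle⟩ := h
    refine ⟨i, Finset.mem_univ _, fun x => ?_⟩
    by_cases hx : x.1 = x.2
    · obtain ⟨a, b⟩ := x
      obtain rfl : a = b := hx
      rw [hdiag i hi]
      exact Nat.zero_le _
    · simpa [hoff j x (Or.inl hx)] using hle x
  · have h0 (j : Fin (k + 1)) : (diagonalOrder (k + 1)).degree (detAndCorners K k 0) ≤
        d + (diagonalOrder (k + 1)).degree ((genericMatrix K (k + 1)).adjugate j j) := by
      obtain ⟨i, -, hle⟩ := hd j
      obtain rfl : i = 0 := by
        by_contra hi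
        exact h ⟨j, i, hi, hle⟩
      exact hle
    refine ⟨0, Finset.mem_univ _, fun x => ?_⟩
    by_cases hx : x.1 = x.2
    · obtain ⟨a, b⟩ := x
      obtain rfl : a = b := hx
      simpa [hoff a (a, a) (Or.inr rfl)] using h0 a (a, a)
    · rw [degree_detAndCorners_apply_eq_zero K k 0 x hx]
      exact Nat.zero_le _

theorem mem_mulRangeSup_genericMatrix_iff
    {A : Matrix (Fin (k + 1)) (Fin (k + 1)) (MvPolynomial (Fin (k + 1) × Fin (k + 1)) K)} :
    A ∈ mulRangeSup (genericMatrix K (k + 1)) ↔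
      (genericMatrix K (k + 1)).det ∣ ((genericMatrix K (k + 1)).adjugate * A).trace := by
  refine ⟨det_dvd_trace_of_mem, fun h => ?_⟩
  have key (s : Finset (Fin 3)) {i : Fin 3} (hi : i ∉ s)
      (z : MvPolynomial (Fin (k + 1) × Fin (k + 1)) K)
      (hz : z * detAndCorners K k i ∈ Ideal.span (detAndCorners K k '' s)) :=
    (diagonalOrder (k + 1)).mem_span_of_mul_mem (isUnit_leadingCoeff_detAndCorners K k)
      (disjoint_degree_detAndCorners K k) s hi hz
  have h1 := key {0} (i := 1) (by decide)
  have h2 := key {0, 1} (i := 2) (by decide)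
  have h4 := key {1} (i := 2) (by decide)
  have h5 := key {1, 2} (i := 0) (by decide)
  have h6 (s) := mem_span_of_forall_mul_adjugate_mem K k (s := s)
  have huniv : (Finset.univ : Finset (Fin 3)) = {0, 1, 2} := rfl
  simp only [huniv, Finset.coe_insert, Finset.coe_singleton, Set.image_insert_eq,
    Set.image_singleton, Ideal.mem_span_singleton] at h1 h2 h4 h5 h6
  exact mem_mulRangeSup_of_adjugate_smul_mem
    (IsRegular.of_ne_zero (det_genericMatrix_ne_zero K (k + 1)) |>.left) h1 h2
    (IsRegular.of_ne_zero (adjugate_genericMatrix_ne_zero K k _ _) |>.left) h4 h5 h6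
    (adjugate_smul_mem_of_dvd_trace h)

end Generic

namespace Matrix

section CommRing

variable {ι S : Type*} [Fintype ι] [DecidableEq ι] [CommRing S]

/-- The map sending a matrix `A` to the homomorphism from the free module to the cokernel of `X`
that it induces, modulo the homomorphisms that factor through `X`. -/
def toHomCokernel (X : Matrix ι ι S) : Matrix ι ι S →ₗ[S]
    ((ι → S) →ₗ[S] ((ι → S) ⧸ LinearMap.range X.mulVecLin)) ⧸
      LinearMap.range (LinearMap.lcomp S ((ι → S) ⧸ LinearMap.range X.mulVecLin) X.mulVecLin) :=
  (Submodule.mkQ _ ∘ₗ LinearMap.llcomp S (ι → S) _ _ (LinearMap.range X.mulVecLin).mkQ) ∘ₗ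
    (Matrix.toLin' (R := S) (m := ι) (n := ι)).toLinearMap

theorem exists_mkQ_comp_mulVecLin (X : Matrix ι ι S)
    (φ : (ι → S) →ₗ[S] ((ι → S) ⧸ LinearMap.range X.mulVecLin)) :
    ∃ A : Matrix ι ι S, (LinearMap.range X.mulVecLin).mkQ ∘ₗ A.mulVecLin = φ := by
  obtain ⟨g, hg⟩ := Module.projective_lifting_property _ φ
    (Submodule.mkQ_surjective (LinearMap.range X.mulVecLin))
  exact ⟨LinearMap.toMatrix' g,
    (congrArg ((LinearMap.range X.mulVecLin).mkQ ∘ₗ ·) (toLin'_toMatrix' g)).trans hg⟩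

theorem toHomCokernel_surjective (X : Matrix ι ι S) : Function.Surjective (toHomCokernel X) := by
  intro y
  obtain ⟨φ, rfl⟩ := Submodule.mkQ_surjective _ y
  obtain ⟨A, rfl⟩ := exists_mkQ_comp_mulVecLin X φ
  exact ⟨A, rfl⟩

theorem exists_mul_eq_of_mkQ_comp_eq_zero {X A : Matrix ι ι S}
    (h : (LinearMap.range X.mulVecLin).mkQ ∘ₗ A.mulVecLin = 0) : ∃ M, X * M = A := by
  have h' (j : ι) : ∃ v, X *ᵥ v = A.col j := by
    have := LinearMap.congr_fun h (Pi.single j 1)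
    obtain ⟨v, hv⟩ := (Submodule.Quotient.mk_eq_zero _).1 this
    exact ⟨v, by simpa using hv⟩
  choose v hv using h'
  refine ⟨(of v)ᵀ, ?_⟩
  ext i j
  exact congrFun (hv j) i

theorem ker_toHomCokernel (X : Matrix ι ι S) :
    LinearMap.ker (toHomCokernel X) = mulRangeSup X := by
  ext A
  rw [LinearMap.mem_ker, mem_mulRangeSup]
  change Submodule.Quotient.mk ((LinearMap.range X.mulVecLin).mkQ ∘ₗ A.mulVecLin) = 0 ↔ _
  rw [Submodule.Quotient.mk_eq_zero]
  constructor
  · rintro ⟨φ, hφ⟩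
    obtain ⟨N, rfl⟩ := exists_mkQ_comp_mulVecLin X φ
    obtain ⟨M, hM⟩ := exists_mul_eq_of_mkQ_comp_eq_zero (X := X) (A := A - N * X) (by
      have hsub : (A - N * X).mulVecLin = A.mulVecLin - (N * X).mulVecLin := map_sub toLin' _ _
      rw [hsub, LinearMap.comp_sub, ← hφ, mulVecLin_mul]
      exact sub_self _)
    exact ⟨M, N, by rw [hM, sub_add_cancel]⟩
  · rintro ⟨M, N, rfl⟩
    refine ⟨(LinearMap.range X.mulVecLin).mkQ ∘ₗ N.mulVecLin, ?_⟩
    rw [mulVecLin_add, LinearMap.comp_add, mulVecLin_mul, mulVecLin_mul, ← LinearMap.comp_assoc,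
      LinearMap.range_mkQ_comp, LinearMap.zero_comp, zero_add]
    rfl

/-- The map `A ↦ tr (adj X * A)`, with values in the quotient by `det X`. -/
def adjugateTraceMod (X : Matrix ι ι S) : Matrix ι ι S →ₗ[S] S ⧸ Ideal.span {X.det} :=
  (Ideal.Quotient.mkₐ S (Ideal.span {X.det})).toLinearMap ∘ₗ Matrix.traceLinearMap ι S S ∘ₗ
    LinearMap.mulLeft S X.adjugate

theorem adjugateTraceMod_apply (X A : Matrix ι ι S) :
    adjugateTraceMod X A = Ideal.Quotient.mk _ (X.adjugate * A).trace := rfl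

theorem range_trace_adjugate_mul (X : Matrix ι ι S) :
    LinearMap.range (Matrix.traceLinearMap ι S S ∘ₗ LinearMap.mulLeft S X.adjugate) =
      Ideal.span (Set.range fun p : ι × ι => X.adjugate p.1 p.2) := by
  apply le_antisymm
  · rintro _ ⟨A, rfl⟩
    simp only [LinearMap.comp_apply, LinearMap.mulLeft_apply, traceLinearMap_apply, trace,
      diag_apply, mul_apply]
    exact sum_mem fun i _ => sum_mem fun j _ =>
      Ideal.mul_mem_right _ _ (Ideal.subset_span ⟨(i, j), rfl⟩)
  · refine Ideal.span_le.2 ?_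
    rintro _ ⟨⟨i, j⟩, rfl⟩
    exact ⟨single j i 1, by simp [trace_mul_single]⟩

theorem range_adjugateTraceMod (X : Matrix ι ι S) :
    LinearMap.range (adjugateTraceMod X) =
      ((Ideal.span (Set.range fun p : ι × ι => X.adjugate p.1 p.2)).map
        (Ideal.Quotient.mk (Ideal.span {X.det}))).restrictScalars S := by
  ext y
  rw [adjugateTraceMod, LinearMap.range_comp, range_trace_adjugate_mul, Submodule.mem_map,
    Submodule.restrictScalars_mem,
    Ideal.mem_map_iff_of_surjective _ Ideal.Quotient.mk_surjective]
  rfl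

end CommRing

theorem _root_.StrictMono.exists_eq_succAbove {k : ℕ} {f : Fin k → Fin (k + 1)}
    (hf : StrictMono f) : ∃ p : Fin (k + 1), f = p.succAbove := by
  obtain ⟨p, hp⟩ : ∃ p, p ∉ Set.range f := by
    by_contra! h
    simpa using Fintype.card_le_of_surjective f h
  refine ⟨p, (hf.range_inj (Fin.strictMono_succAbove p)).1 ?_⟩
  rw [Fin.range_succAbove]
  have hp' : Finset.univ.image f ⊆ {p}ᶜ := by
    intro x hx
    simp only [Finset.mem_compl, Finset.mem_singleton]
    rintro rfl
    simp_all
  have := Finset.eq_of_subset_of_card_le hp' (by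
    simp [Finset.card_image_of_injective _ hf.injective, Finset.card_compl])
  simpa using congrArg ((↑) : Finset (Fin (k + 1)) → Set (Fin (k + 1))) this

theorem minorsIdeal_succ (K : Type*) [CommRing K] (k : ℕ) :
    minorsIdeal K (k + 1) = Ideal.span (Set.range fun p : Fin (k + 1) × Fin (k + 1) =>
      (genericMatrix K (k + 1)).adjugate p.1 p.2) := by
  apply le_antisymm
  · refine Ideal.span_le.2 ?_
    rintro _ ⟨f, g, hf, hg, rfl⟩
    obtain ⟨p, rfl⟩ := hf.exists_eq_succAbove
    obtain ⟨q, rfl⟩ := hg.exists_eq_succAbove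
    have h := adjugate_fin_succ_eq_det_submatrix (genericMatrix K (k + 1)) q p
    rw [SetLike.mem_coe, ← (Ideal.unit_mul_mem_iff_mem _ ((isUnit_one.neg).pow (p + q : ℕ))),
      ← h]
    exact Ideal.subset_span ⟨(q, p), rfl⟩
  · refine Ideal.span_le.2 ?_
    rintro _ ⟨⟨i, j⟩, rfl⟩
    change (genericMatrix K (k + 1)).adjugate i j ∈ minorsIdeal K (k + 1)
    rw [adjugate_fin_succ_eq_det_submatrix]
    exact Ideal.mul_mem_left _ _ (Ideal.subset_span
      ⟨_, _, Fin.strictMono_succAbove j, Fin.strictMono_succAbove i, rfl⟩)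

theorem ker_adjugateTraceMod_genericMatrix (K : Type*) [CommRing K] [IsDomain K] (k : ℕ) :
    LinearMap.ker (adjugateTraceMod (genericMatrix K (k + 1))) =
      mulRangeSup (genericMatrix K (k + 1)) := by
  ext A
  rw [LinearMap.mem_ker, adjugateTraceMod_apply, Ideal.Quotient.eq_zero_iff_mem,
    Ideal.mem_span_singleton, mem_mulRangeSup_genericMatrix_iff]

end Matrix

section TwoTermResolution

universe u

variable {S : Type u} [CommRing S] {P Q : Type u} [AddCommGroup P] [Module S P]
  [AddCommGroup Q] [Module S Q] (f : P →ₗ[S] Q)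

/-- The objects of the two-term complex `P ⟶ Q`, placed in degrees `1` and `0`. -/
def twoTermObj (P Q : Type u) [AddCommGroup P] [Module S P] [AddCommGroup Q] [Module S Q] :
    ℕ → ModuleCat.{u} S
  | 0 => ModuleCat.of S Q
  | 1 => ModuleCat.of S P
  | _ + 2 => ModuleCat.of S PUnit

/-- The differentials of the two-term complex `P ⟶ Q`. -/
def twoTermMap : ∀ i, twoTermObj (S := S) P Q (i + 1) ⟶ twoTermObj (S := S) P Q i
  | 0 => ModuleCat.ofHom f
  | _ + 1 => 0

/-- A linear map `f : P → Q`, seen as a chain complex in degrees `1` and `0`. -/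
def twoTermComplex : ChainComplex (ModuleCat.{u} S) ℕ :=
  ChainComplex.of (twoTermObj P Q) (twoTermMap f) fun _ => Limits.zero_comp

theorem twoTermComplex_d_one_zero : (twoTermComplex f).d 1 0 = ModuleCat.ofHom f :=
  ChainComplex.of_d (twoTermObj P Q) (twoTermMap f) 0

theorem twoTermComplex_d_succ_succ (i : ℕ) : (twoTermComplex f).d (i + 2) (i + 1) = 0 :=
  ChainComplex.of_d _ _ (i + 1)

/-- The augmentation of the two-term complex `f` to the cokernel of `f`. -/
def twoTermAugmentation :
    twoTermComplex f ⟶ (ChainComplex.single₀ (ModuleCat.{u} S)).obj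
      (ModuleCat.of S (Q ⧸ LinearMap.range f)) :=
  ((twoTermComplex f).toSingle₀Equiv _).symm ⟨ModuleCat.ofHom (LinearMap.range f).mkQ, by
    rw [twoTermComplex_d_one_zero]
    ext x
    exact (Submodule.Quotient.mk_eq_zero _).2 ⟨x, rfl⟩⟩

theorem twoTermAugmentation_f_zero :
    (twoTermAugmentation f).f 0 = ModuleCat.ofHom (LinearMap.range f).mkQ := by
  simp [twoTermAugmentation, ChainComplex.toSingle₀Equiv]
  rfl

theorem quasiIso_twoTermAugmentation (hf : Function.Injective f) :
    QuasiIso (twoTermAugmentation f) where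
  quasiIsoAt i := by
    match i with
    | 0 =>
      rw [ChainComplex.quasiIsoAt₀_iff, ShortComplex.quasiIso_iff_of_zeros' _ rfl rfl rfl]
      constructor
      · rw [ShortComplex.moduleCat_exact_iff]
        intro x hx
        change (twoTermAugmentation f).f 0 x = 0 at hx
        rw [twoTermAugmentation_f_zero] at hx
        obtain ⟨y, hy⟩ := (Submodule.Quotient.mk_eq_zero _).1 hx
        refine ⟨y, ?_⟩
        change (twoTermComplex f).d 1 0 y = x
        rw [twoTermComplex_d_one_zero]
        exact hy
      · change Epi ((twoTermAugmentation f).f 0)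
        rw [twoTermAugmentation_f_zero]
        exact (ModuleCat.epi_iff_surjective _).2 (Submodule.mkQ_surjective _)
    | 1 =>
      rw [quasiIsoAt_iff_exactAt' (hL := ChainComplex.exactAt_succ_single_obj ..),
        HomologicalComplex.exactAt_iff' _ 2 1 0 (by simp) (by simp),
        ShortComplex.moduleCat_exact_iff]
      intro x hx
      refine ⟨0, ?_⟩
      have h : (ModuleCat.ofHom f) x = 0 := by
        rw [← twoTermComplex_d_one_zero]
        exact hx
      rw [map_zero]
      exact (hf (h.trans (map_zero f).symm)).symm
    | i + 2 =>
      rw [quasiIsoAt_iff_exactAt' (hL := ChainComplex.exactAt_succ_single_obj ..)]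
      refine ShortComplex.exact_of_isZero_X₂ _ ?_
      exact ModuleCat.isZero_of_subsingleton (ModuleCat.of S PUnit)

/-- An injective linear map between projective modules is a projective resolution of its
cokernel. -/
def twoTermResolution [Module.Projective S P] [Module.Projective S Q]
    (hf : Function.Injective f) :
    ProjectiveResolution (ModuleCat.of S (Q ⧸ LinearMap.range f)) where
  complex := twoTermComplex f
  projective i := match i with
    | 0 => inferInstanceAs (Projective (ModuleCat.of S Q))
    | 1 => inferInstanceAs (Projective (ModuleCat.of S P))
    | _ + 2 => inferInstanceAs (Projective (ModuleCat.of S PUnit))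
  π := twoTermAugmentation f
  quasiIso := quasiIso_twoTermAugmentation f hf

theorem nonempty_extOne_equiv [Module.Projective S P] [Module.Projective S Q]
    (hf : Function.Injective f) (Y : Type u) [AddCommGroup Y] [Module S Y] :
    Nonempty ((((Ext S (ModuleCat.{u} S) 1).obj
      (Opposite.op (ModuleCat.of S (Q ⧸ LinearMap.range f)))).obj (ModuleCat.of S Y)) ≃ₗ[S]
      ((P →ₗ[S] Y) ⧸ LinearMap.range (LinearMap.lcomp S Y f))) := by
  let C := (twoTermComplex f).linearYonedaObj S (ModuleCat.of S Y)
  have hC : C.d 1 2 = 0 := by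
    refine ModuleCat.hom_ext (LinearMap.ext fun φ => ?_)
    change (twoTermComplex f).d 2 1 ≫ φ = 0
    rw [twoTermComplex_d_succ_succ]
    exact Limits.zero_comp
  let e : (P →ₗ[S] Y) ≃ₗ[S] C.X 1 := 
    (ModuleCat.homLinearEquiv (M := ModuleCat.of S P) (N := ModuleCat.of S Y) (S := S)).symm
  let e' : (Q →ₗ[S] Y) ≃ₗ[S] C.X 0 :=
    (ModuleCat.homLinearEquiv (M := ModuleCat.of S Q) (N := ModuleCat.of S Y) (S := S)).symm
  have i1 := ((twoTermResolution f hf).isoExt (R := S) 1 (ModuleCat.of S Y)).toLinearEquiv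
  have i2 := (C.isoHomologyι 1 2 (by simp) hC).toLinearEquiv
  have i3 := ((C.opcyclesIsCokernel 0 1 (by simp)).coconePointUniqueUpToIso
    (ModuleCat.cokernelIsColimit (C.d 0 1))).toLinearEquiv
  have i4 : ((P →ₗ[S] Y) ⧸ LinearMap.range (LinearMap.lcomp S Y f)) ≃ₗ[S]
    (C.X 1 ⧸ LinearMap.range (C.d 0 1).hom) :=
    Submodule.Quotient.equiv _ _ e (by
      have : (C.d 0 1).hom ∘ₗ e'.toLinearMap = e.toLinearMap ∘ₗ LinearMap.lcomp S Y f := by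
        refine LinearMap.ext fun φ => ?_
        change (twoTermComplex f).d 1 0 ≫ ModuleCat.ofHom φ = _
        rw [twoTermComplex_d_one_zero]
        rfl
      rw [← LinearMap.range_comp, ← this, LinearMap.range_comp_of_range_eq_top]
      exact e'.range)
  exact ⟨i1 ≪≫ₗ i2 ≪≫ₗ i3 ≪≫ₗ i4.symm⟩

end TwoTermResolution
set_option synthInstance.maxHeartbeats 1000000 in
set_option maxHeartbeats 1000000 in
/-- Let `K` be a commutative Noetherian normal domain, `n ≥ 2`, `X` the
generic `n × n` matrix over `K`, `S = K[x_{ij}]`, `R = S/(det X)`, and `L = coker(X : Sⁿ → Sⁿ)`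
as an `S`-module.  Then `Ext¹_S(L, L)` is isomorphic, as an `S`-module, to the ideal
`I_{n-1}(X)/(det X)` of `R`, i.e. the image of `I_{n-1}(X)` in `R = S/(det X)`. -/
theorem statement14 (K : Type*) [CommRing K] [IsDomain K] [IsNoetherianRing K]
    [IsIntegrallyClosed K] (n : ℕ) (hn : 2 ≤ n) :
    letI S := MvPolynomial (Fin n × Fin n) K
    letI L := (Fin n → S) ⧸ LinearMap.range (Matrix.mulVecLin (genericMatrix K n))
    Nonempty ((((Ext S (ModuleCat S) 1).obj
        (Opposite.op (ModuleCat.of S L))).obj (ModuleCat.of S L)) ≃ₗ[S]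
      (Submodule.restrictScalars (MvPolynomial (Fin n × Fin n) K)
        ((minorsIdeal K n).map
          (Ideal.Quotient.mk (Ideal.span {(genericMatrix K n).det}))))) := by
  obtain ⟨k, rfl⟩ : ∃ k, n = k + 1 := ⟨n - 1, by omega⟩
  have hinj : Function.Injective (genericMatrix K (k + 1)).mulVecLin := by
    rw [← LinearMap.ker_eq_bot, Matrix.ker_mulVecLin_eq_bot_iff]
    intro v hv
    by_contra hv0
    exact det_genericMatrix_ne_zero K (k + 1) (Matrix.exists_mulVec_eq_zero_iff.1 ⟨v, hv0, hv⟩)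
  obtain ⟨e⟩ := nonempty_extOne_equiv _ hinj
    ((Fin (k + 1) → MvPolynomial (Fin (k + 1) × Fin (k + 1)) K) ⧸
      LinearMap.range (genericMatrix K (k + 1)).mulVecLin)
  have e₁ := (toHomCokernel (genericMatrix K (k + 1))).quotKerEquivOfSurjective
    (toHomCokernel_surjective _)
  have e₂ := Submodule.quotEquivOfEq _ _ ((ker_toHomCokernel (genericMatrix K (k + 1))).trans
    (ker_adjugateTraceMod_genericMatrix K k).symm)
  have e₃ := (adjugateTraceMod (genericMatrix K (k + 1))).quotKerEquivRange
  have e₄ := LinearEquiv.ofEq _ _ (range_adjugateTraceMod (genericMatrix K (k + 1)))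
  rw [minorsIdeal_succ]
  exact ⟨e ≪≫ₗ e₁.symm ≪≫ₗ e₂ ≪≫ₗ e₃ ≪≫ₗ e₄⟩

end
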